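/- Let C be the generalised Cantor set generated by a sequence (λ_i) with λ_i ∈ (0,1/2). If there exists λ ∈ (0,1/2) and a sequence (j_m)_{m∈ℕ} of nonnegative integers such that for each m ∈ ℕ the m consecutive generators satisfy λ_{j_m+1}, …, λ_{j_m+m} ≥ λ, then dim_A C ≥ −log 2/log λ. -/

import Mathlib

open Metric Set Filter
open scoped ENNReal NNReal

namespace Paper

noncomputable def coverNum {X : Type*} [MetricSpace X] (F : Set X) (r : ℝ) : ℝ≥0∞ :=
  ⨅ (s : Finset X) (_ : F ⊆ ⋃ x ∈ s, closedBall x r), (s.card : ℝ≥0∞)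

noncomputable def diamCoverNum {X : Type*} [MetricSpace X] (F : Set X) (r : ℝ) : ℝ≥0∞ :=
  ⨅ (U : Finset (Set X)) (_ : F ⊆ ⋃₀ ↑U)
    (_ : ∀ A ∈ U, EMetric.diam A ≤ ENNReal.ofReal r), (U.card : ℝ≥0∞)

noncomputable def lowerBoxDim {X : Type*} [MetricSpace X] (F : Set X) : ℝ :=
  Filter.liminf (fun r : ℝ => Real.log (coverNum F r).toReal / (-Real.log r))
    (nhdsWithin 0 (Set.Ioi 0))

noncomputable def upperBoxDim {X : Type*} [MetricSpace X] (F : Set X) : ℝ :=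
  Filter.limsup (fun r : ℝ => Real.log (coverNum F r).toReal / (-Real.log r))
    (nhdsWithin 0 (Set.Ioi 0))

def IsHomogeneous {X : Type*} [MetricSpace X] (F : Set X) (s : ℝ) : Prop :=
  ∀ δ₀ : ℝ, 0 < δ₀ → ∃ C : ℝ, 0 < C ∧
    ∀ x ∈ F, ∀ δ ρ : ℝ, 0 < ρ → ρ < δ → δ ≤ δ₀ →
      coverNum (closedBall x δ ∩ F) ρ ≤ ENNReal.ofReal (C * (δ / ρ) ^ s)

noncomputable def assouadDim {X : Type*} [MetricSpace X] (F : Set X) : EReal :=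
  sInf ((fun s : ℝ => (s : EReal)) '' {s : ℝ | 0 ≤ s ∧ IsHomogeneous F s})

def EquiHomogeneous {X : Type*} [MetricSpace X] (F : Set X) : Prop :=
  ∀ δ₀ : ℝ, 0 < δ₀ → ∃ M : ℝ≥0, 1 ≤ M ∧ ∃ c₁ c₂ : ℝ, 0 < c₁ ∧ 0 < c₂ ∧
    ∀ δ ρ : ℝ, 0 < ρ → ρ < δ → δ ≤ δ₀ →
      (⨆ x ∈ F, coverNum (closedBall x δ ∩ F) ρ) ≤
        (M : ℝ≥0∞) * ⨅ x ∈ F, coverNum (closedBall x (c₁ * δ) ∩ F) (c₂ * ρ)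

noncomputable def cantorLen (lam : ℕ → ℝ) (n : ℕ) : ℝ := ∏ i ∈ Finset.range n, lam i

noncomputable def cantorPre (lam : ℕ → ℝ) (n : ℕ) : Set ℝ :=
  ⋃ ε : ℕ → Bool,
    Set.Icc (∑ i ∈ Finset.range n, if ε i then cantorLen lam i - cantorLen lam (i + 1) else 0)
      ((∑ i ∈ Finset.range n, if ε i then cantorLen lam i - cantorLen lam (i + 1) else 0) +
        cantorLen lam n)

noncomputable def cantorSet (lam : ℕ → ℝ) : Set ℝ := ⋂ n : ℕ, cantorPre lam n

open Classical in
noncomputable def lamSeq (q : ℝ) (a : ℕ → ℕ) (i : ℕ) : ℝ :=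
  if h : ∃ k : ℕ, i + 1 = ∑ j ∈ Finset.range (k + 1), a (2 * j) then
    q ^ (a (2 * h.choose + 1) + 1)
  else q

open Classical in
noncomputable def muSeq (q : ℝ) (a : ℕ → ℕ) (i : ℕ) : ℝ :=
  if h : ∃ k : ℕ, i + 1 = a 0 + ∑ j ∈ Finset.range (k + 1), a (2 * j + 1) then
    q ^ (a (2 * h.choose + 2) + 1)
  else q

noncomputable def prodSetL2 (C D : Set ℝ) : Set (WithLp 2 (ℝ × ℝ)) :=
  (WithLp.equiv 2 (ℝ × ℝ)).symm '' (C ×ˢ D)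

/-- The left endpoint of the interval of `cantorPre lam n` with address `ε`. -/
noncomputable def cantorLeft (lam : ℕ → ℝ) (ε : ℕ → Bool) (n : ℕ) : ℝ :=
  ∑ i ∈ Finset.range n, if ε i then cantorLen lam i - cantorLen lam (i + 1) else 0

section

variable {lam : ℕ → ℝ}

lemma cantorLen_succ (n : ℕ) : cantorLen lam (n + 1) = cantorLen lam n * lam n :=
  Finset.prod_range_succ _ _

lemma cantorLeft_succ (ε : ℕ → Bool) (n : ℕ) :
    cantorLeft lam ε (n + 1) =
      cantorLeft lam ε n + if ε n then cantorLen lam n - cantorLen lam (n + 1) else 0 :=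
  Finset.sum_range_succ _ _

lemma cantorLeft_congr {ε ε' : ℕ → Bool} {n : ℕ} (h : ∀ i < n, ε i = ε' i) :
    cantorLeft lam ε n = cantorLeft lam ε' n :=
  Finset.sum_congr rfl fun i hi => by rw [h i (Finset.mem_range.1 hi)]

lemma cantorLeft_false (n : ℕ) : cantorLeft lam (fun _ => false) n = 0 := by
  simp [cantorLeft]

lemma cantorLen_pos (hlam : ∀ i, lam i ∈ Ioo (0 : ℝ) (1 / 2)) (n : ℕ) : 0 < cantorLen lam n :=
  Finset.prod_pos fun i _ => (hlam i).1

lemma two_mul_cantorLen_succ_lt (hlam : ∀ i, lam i ∈ Ioo (0 : ℝ) (1 / 2)) (n : ℕ) :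
    2 * cantorLen lam (n + 1) < cantorLen lam n := by
  rw [cantorLen_succ]
  nlinarith [cantorLen_pos hlam n, (hlam n).2]

lemma cantorLen_le_one (hlam : ∀ i, lam i ∈ Ioo (0 : ℝ) (1 / 2)) (n : ℕ) :
    cantorLen lam n ≤ 1 :=
  Finset.prod_le_one (fun i _ => (hlam i).1.le) fun i _ => by linarith [(hlam i).2]

lemma pow_mul_cantorLen_le (hlam : ∀ i, lam i ∈ Ioo (0 : ℝ) (1 / 2)) {l : ℝ} (hl : 0 ≤ l)
    {n m : ℕ} (h : ∀ i < m, l ≤ lam (n + i)) :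
    l ^ m * cantorLen lam n ≤ cantorLen lam (n + m) := by
  have key : l ^ m ≤ ∏ i ∈ Finset.range m, lam (n + i) := by
    calc l ^ m = ∏ _i ∈ Finset.range m, l := by simp
      _ ≤ _ := Finset.prod_le_prod (fun _ _ => hl) fun i hi => h i (Finset.mem_range.1 hi)
  have e : cantorLen lam (n + m) = cantorLen lam n * ∏ i ∈ Finset.range m, lam (n + i) :=
    Finset.prod_range_add _ _ _
  rw [e, mul_comm]
  exact mul_le_mul_of_nonneg_left key (cantorLen_pos hlam n).le

/-- The intervals with address `ε` are nested. -/
lemma cantorLeft_nested (hlam : ∀ i, lam i ∈ Ioo (0 : ℝ) (1 / 2)) (ε : ℕ → Bool) {a b : ℕ}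
    (hab : a ≤ b) :
    cantorLeft lam ε a ≤ cantorLeft lam ε b ∧
      cantorLeft lam ε b + cantorLen lam b ≤ cantorLeft lam ε a + cantorLen lam a := by
  induction b, hab using Nat.le_induction with
  | base => exact ⟨le_rfl, le_rfl⟩
  | succ b _ ih =>
    have h1 := two_mul_cantorLen_succ_lt hlam b
    have h2 := cantorLen_pos hlam (b + 1)
    rw [cantorLeft_succ]
    split_ifs <;> constructor <;> linarith [ih.1, ih.2]

lemma cantorLeft_mem_cantorSet (hlam : ∀ i, lam i ∈ Ioo (0 : ℝ) (1 / 2)) (ε : ℕ → Bool) {N : ℕ}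
    (hε : ∀ i, N ≤ i → ε i = false) : cantorLeft lam ε N ∈ cantorSet lam := by
  refine mem_iInter.2 fun k => mem_iUnion.2 ⟨ε, ?_⟩
  change cantorLeft lam ε k ≤ _ ∧ _ ≤ cantorLeft lam ε k + cantorLen lam k
  rcases le_total k N with hk | hk
  · have := cantorLeft_nested hlam ε hk
    exact ⟨this.1, by linarith [this.2, cantorLen_pos hlam N]⟩
  · have : cantorLeft lam ε k = cantorLeft lam ε N := by
      induction k, hk using Nat.le_induction with
      | base => rfl
      | succ k hk ih => simp [cantorLeft_succ, hε k hk, ih]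
    rw [this]
    exact ⟨le_rfl, by linarith [cantorLen_pos hlam k]⟩

lemma cantorLen_lt_dist_cantorLeft (hlam : ∀ i, lam i ∈ Ioo (0 : ℝ) (1 / 2)) {ε ε' : ℕ → Bool}
    {N : ℕ} (h : ∃ i < N, ε i ≠ ε' i) :
    cantorLen lam N < dist (cantorLeft lam ε N) (cantorLeft lam ε' N) := by
  classical
  obtain ⟨hkN, hk⟩ := Nat.find_spec h
  set k := Nat.find h
  have heq : cantorLeft lam ε k = cantorLeft lam ε' k := cantorLeft_congr fun i hi => by
    by_contra hne
    exact Nat.find_min h hi ⟨hi.trans hkN, hne⟩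
  have h1 := cantorLeft_nested hlam ε (Nat.succ_le_of_lt hkN)
  have h2 := cantorLeft_nested hlam ε' (Nat.succ_le_of_lt hkN)
  have h3 := two_mul_cantorLen_succ_lt hlam k
  simp only [Nat.succ_eq_add_one, cantorLeft_succ] at h1 h2
  rw [Real.dist_eq, lt_abs]
  cases hb : ε k <;> cases hb' : ε' k
  · simp [hb, hb'] at hk
  · right
    simp only [hb, hb', if_true, Bool.false_eq_true, if_false] at h1 h2
    linarith [h1.2, h2.1]
  · left
    simp only [hb, hb', if_true, Bool.false_eq_true, if_false] at h1 h2
    linarith [h1.1, h2.2]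
  · simp [hb, hb'] at hk

end

/-- A family of points of `F` with pairwise distances exceeding `2 * r` bounds `coverNum F r`
from below. -/
lemma card_le_coverNum {X ι : Type*} [MetricSpace X] {F : Set X} {r : ℝ} (t : Finset ι)
    (f : ι → X) (hf : ∀ a ∈ t, f a ∈ F)
    (hsep : ∀ a ∈ t, ∀ b ∈ t, a ≠ b → 2 * r < dist (f a) (f b)) :
    (t.card : ℝ≥0∞) ≤ coverNum F r := by
  refine le_iInf₂ fun s hs => ?_
  have hc : ∀ a ∈ t, ∃ x ∈ s, f a ∈ closedBall x r := fun a ha => by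
    simpa using hs (hf a ha)
  obtain rfl | ⟨a₀, -⟩ := t.eq_empty_or_nonempty
  · simp
  have : Nonempty X := ⟨f a₀⟩
  choose! c hcs hcb using hc
  refine Nat.cast_le.2 (Finset.card_le_card_of_injOn c hcs fun a ha b hb hab => ?_)
  by_contra hne
  have h1 := mem_closedBall.1 (hcb a ha)
  have h2 := mem_closedBall.1 (hcb b hb)
  rw [← hab] at h2
  linarith [hsep a ha b hb hne, dist_triangle_right (f a) (f b) (c a)]

lemma two_pow_le_coverNum_cantorSet {lam : ℕ → ℝ} (hlam : ∀ i, lam i ∈ Ioo (0 : ℝ) (1 / 2))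
    (n m : ℕ) :
    (2 : ℝ≥0∞) ^ m ≤
      coverNum (closedBall 0 (cantorLen lam n) ∩ cantorSet lam) (cantorLen lam (n + m) / 2) := by
  have key := card_le_coverNum (F := closedBall 0 (cantorLen lam n) ∩ cantorSet lam)
    (r := cantorLen lam (n + m) / 2) (Finset.Ico n (n + m)).powerset
    (fun T => cantorLeft lam (fun i => decide (i ∈ T)) (n + m)) ?_ ?_
  · simpa using key
  · intro T hT
    rw [Finset.mem_powerset] at hT
    refine ⟨?_, cantorLeft_mem_cantorSet hlam _ fun i hi => decide_eq_false fun h => ?_⟩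
    · have h0 : cantorLeft lam (fun i => decide (i ∈ T)) n = 0 := by
        rw [← cantorLeft_false (lam := lam) n]
        refine cantorLeft_congr fun i hi => decide_eq_false fun h => ?_
        have := Finset.mem_Ico.1 (hT h)
        omega
      have h1 := cantorLeft_nested hlam (fun i => decide (i ∈ T)) (Nat.le_add_right n m)
      rw [h0] at h1
      rw [mem_closedBall, Real.dist_eq, sub_zero, abs_of_nonneg h1.1]
      linarith [h1.2, cantorLen_pos hlam (n + m)]
    · have := Finset.mem_Ico.1 (hT h)
      omega
  · intro S hS T hT hne
    rw [mul_div_cancel₀ _ (two_ne_zero' ℝ)]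
    refine cantorLen_lt_dist_cantorLeft hlam ?_
    by_contra! hcon
    refine hne (Finset.ext fun i => ?_)
    rw [Finset.mem_powerset] at hS hT
    by_cases hi : i < n + m
    · simpa using hcon i hi
    · exact ⟨fun h => absurd (Finset.mem_Ico.1 (hS h)).2 hi,
        fun h => absurd (Finset.mem_Ico.1 (hT h)).2 hi⟩

theorem statement12 (lam : ℕ → ℝ) (hlam : ∀ i, lam i ∈ Set.Ioo (0 : ℝ) (1 / 2))
    (l : ℝ) (hl : l ∈ Set.Ioo (0 : ℝ) (1 / 2)) (j : ℕ → ℕ)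
    (hj : ∀ m : ℕ, ∀ i < m, l ≤ lam (j m + i)) :
    ((-(Real.log 2 / Real.log l) : ℝ) : EReal) ≤ assouadDim (cantorSet lam) := by
  refine le_sInf ?_
  rintro _ ⟨s, ⟨hs0, hs⟩, rfl⟩
  rw [EReal.coe_le_coe_iff]
  by_contra! hlt
  obtain ⟨C, hC, hcov⟩ := hs 1 one_pos
  have hl0 : 0 < l := hl.1
  have hlog : Real.log l < 0 := Real.log_neg hl0 (by linarith [hl.2])
  have hgt : 1 < 2 * l ^ s := by
    have h1 : 0 < Real.log 2 + s * Real.log l := by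
      rw [← div_neg, lt_div_iff₀ (neg_pos.2 hlog)] at hlt
      linarith
    rw [← Real.log_pos_iff (by positivity),
      Real.log_mul two_ne_zero (Real.rpow_pos_of_pos hl0 s).ne', Real.log_rpow hl0]
    exact h1
  obtain ⟨m, hm⟩ := pow_unbounded_of_one_lt (C * 2 ^ s) hgt
  set n := j m
  have hLn := cantorLen_pos hlam n
  have hLN := cantorLen_pos hlam (n + m)
  have hle : cantorLen lam (n + m) ≤ cantorLen lam n := by
    have h := cantorLeft_nested hlam (fun _ => false) (Nat.le_add_right n m)
    simp only [cantorLeft_false] at h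
    linarith [h.2]
  have h0 : (0 : ℝ) ∈ cantorSet lam := by
    simpa [cantorLeft_false] using
      cantorLeft_mem_cantorSet hlam (fun _ => false) (N := 0) fun _ _ => rfl
  have hbound := (two_pow_le_coverNum_cantorSet hlam n m).trans
    (hcov 0 h0 (cantorLen lam n) (cantorLen lam (n + m) / 2) (by positivity) (by linarith)
      (cantorLen_le_one hlam n))
  have hreal : (2 : ℝ) ^ m ≤ C * (cantorLen lam n / (cantorLen lam (n + m) / 2)) ^ s := by
    rw [← ENNReal.ofReal_le_ofReal_iff (by positivity), ENNReal.ofReal_pow zero_le_two]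
    simpa using hbound
  have hratio : cantorLen lam n / (cantorLen lam (n + m) / 2) ≤ 2 / l ^ m := by
    rw [div_le_div_iff₀ (by positivity) (by positivity)]
    linarith [pow_mul_cantorLen_le hlam hl0.le (hj m)]
  have hpow : (2 / l ^ m) ^ s = 2 ^ s / (l ^ s) ^ m := by
    rw [Real.div_rpow zero_le_two (by positivity), ← Real.rpow_natCast, ← Real.rpow_natCast,
      ← Real.rpow_mul hl0.le, ← Real.rpow_mul hl0.le, mul_comm]
  have hfin : (2 : ℝ) ^ m ≤ C * 2 ^ s / (l ^ s) ^ m := by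
    rw [mul_div_assoc, ← hpow]
    exact hreal.trans (by gcongr)
  rw [le_div_iff₀ (by positivity), ← mul_pow] at hfin
  exact hfin.not_gt hm

end Paper
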